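/- Let X be a complete metric space, P a porosity-like relation on X, and B a basis of open sets of X. Suppose that N_P(A) is a Suslin set whenever A ⊆ X is Suslin. If S ⊆ X is a Suslin set which is not σ-P-porous, then there exists a (B,P)-Foran scheme F in X such that each element of F is a subset of S. -/

import Mathlib

open Set Metric Filter Topology

/-- `P` is a porosity-like relation on the metric space `X`. -/
def IsPorosityLike (X : Type*) [MetricSpace X] (P : X → Set X → Prop) : Prop :=
  (∀ (x : X) (A B : Set X), A ⊆ B → P x B → P x A) ∧
  (∀ (x : X) (A : Set X), P x A ↔ ∃ r > 0, P x (A ∩ Metric.ball x r)) ∧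
  (∀ (x : X) (A : Set X), P x A ↔ P x (closure A))

/-- A set is `P`-porous if `P x A` holds at every point `x ∈ A`. -/
def PPorous {X : Type*} [MetricSpace X] (P : X → Set X → Prop) (A : Set X) : Prop :=
  ∀ x ∈ A, P x A

/-- A set is σ-`P`-porous if it is a countable union of `P`-porous sets. -/
def SigmaPPorous {X : Type*} [MetricSpace X] (P : X → Set X → Prop) (A : Set X) : Prop :=
  ∃ f : ℕ → Set X, (∀ n, PPorous P (f n)) ∧ A = ⋃ n, f n

/-- `ker_P(A) = A \ ⋃ {U : U open and U ∩ A is σ-P-porous}`. -/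
def kerP {X : Type*} [MetricSpace X] (P : X → Set X → Prop) (A : Set X) : Set X :=
  A \ ⋃₀ {U : Set X | IsOpen U ∧ SigmaPPorous P (U ∩ A)}

/-- `N_P(A) = {x ∈ A : ¬ P(x,A)}`. -/
def NP {X : Type*} [MetricSpace X] (P : X → Set X → Prop) (A : Set X) : Set X :=
  {x ∈ A | ¬ P x A}

/-- The initial segment `ν|n` of an infinite sequence `ν`, as a finite sequence. -/
def seg (ν : ℕ → ℕ) (n : ℕ) : List ℕ := (List.range n).map ν

/-- The Suslin operation applied to a Suslin scheme indexed by finite sequences. -/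
def SuslinOp {X : Type*} (A : List ℕ → Set X) : Set X :=
  ⋃ ν : ℕ → ℕ, ⋂ n : ℕ, A (seg ν n)

/-- A set is Suslin if it is the result of the Suslin operation applied to a scheme
of closed sets. -/
def IsSuslin {X : Type*} [TopologicalSpace X] (S : Set X) : Prop :=
  ∃ A : List ℕ → Set X, (∀ s, IsClosed (A s)) ∧ SuslinOp A = S

/-- `S` is a `(B,P)`-Foran scheme in `X`. -/
def IsForanScheme {X : Type*} [MetricSpace X] (B : Set (Set X)) (P : X → Set X → Prop)
    (S : List ℕ → Set X) : Prop :=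
  (∀ t, (S t).Nonempty) ∧
  (∀ t : List ℕ, (⋃ j : ℕ, S (t ++ [j])) ⊆ S t ∧ S t ⊆ closure (⋃ j : ℕ, S (t ++ [j]))) ∧
  (∀ (t : List ℕ) (k : ℕ), ∀ x ∈ S (t ++ [k]), ¬ P x (S t)) ∧
  (∀ (ν : ℕ → ℕ) (G : ℕ → Set X), (∀ n, G n ∈ B) →
    Filter.Tendsto (fun n => EMetric.diam (G n)) Filter.atTop (nhds 0) →
    (∀ n, closure (G (n + 1)) ⊆ G n) →
    (∀ n, (S (seg ν n) ∩ G n).Nonempty) →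
    (⋂ n, S (seg ν n) ∩ G n).Nonempty)

theorem sigmaPPorous_mono {X : Type*} [MetricSpace X] {P : X → Set X → Prop}
    (hP : IsPorosityLike X P) {A C : Set X} (h : A ⊆ C) (hC : SigmaPPorous P C) :
    SigmaPPorous P A := by
  obtain ⟨f, hf, rfl⟩ := hC
  refine ⟨fun n => A ∩ f n, fun n x hx => hP.1 x _ _ inter_subset_right (hf n x hx.2), ?_⟩
  rw [← inter_iUnion, inter_eq_left.2 h]

theorem sigmaPPorous_iUnion {X : Type*} [MetricSpace X] {P : X → Set X → Prop}
    {A : ℕ → Set X} (h : ∀ n, SigmaPPorous P (A n)) :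
    SigmaPPorous P (⋃ n, A n) := by
  choose f hf hA using h
  refine ⟨fun n => f n.unpair.1 n.unpair.2, fun n => hf _ _, ?_⟩
  ext x
  simp only [mem_iUnion]
  constructor
  · rintro ⟨i, hi⟩
    rw [hA i] at hi
    obtain ⟨j, hj⟩ := mem_iUnion.1 hi
    exact ⟨Nat.pair i j, by simpa using hj⟩
  · rintro ⟨n, hn⟩
    refine ⟨n.unpair.1, ?_⟩
    rw [hA]
    exact mem_iUnion.2 ⟨_, hn⟩

theorem sigmaPPorous_of_pPorous {X : Type*} [MetricSpace X] {P : X → Set X → Prop}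
    {A : Set X} (h : PPorous P A) : SigmaPPorous P A :=
  ⟨fun _ => A, fun _ => h, by simp [iUnion_const]⟩

theorem sigmaPPorous_union {X : Type*} [MetricSpace X] {P : X → Set X → Prop}
    {A C : Set X} (h : SigmaPPorous P A) (h' : SigmaPPorous P C) :
    SigmaPPorous P (A ∪ C) := by
  have := sigmaPPorous_iUnion (P := P) (A := fun n : ℕ => if n = 0 then A else C)
    (fun n => by split_ifs <;> assumption)
  convert this using 1
  ext x
  simp only [mem_union, mem_iUnion]
  constructor
  · rintro (h | h)
    · exact ⟨0, by simpa using h⟩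
    · exact ⟨1, by simpa using h⟩
  · rintro ⟨n, hn⟩
    split_ifs at hn
    · exact Or.inl hn
    · exact Or.inr hn

theorem sigmaPPorous_diff_kerP {X : Type*} [MetricSpace X] {P : X → Set X → Prop}
    (hP : IsPorosityLike X P) (A : Set X) : SigmaPPorous P (A \ kerP P A) := by
  classical
  let I := {U : Set X // IsOpen U ∧ SigmaPPorous P (U ∩ A)}
  have key : ∀ i : I, ∃ f : ℕ → Set X, (∀ n, PPorous P (f n)) ∧ i.1 ∩ A = ⋃ n, f n :=
    fun i => i.2.2
  choose f hf hfA using key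
  let r : I → I → Prop := WellOrderingRel
  let D : ℕ → ℕ → I → Set X := fun n m i =>
    {x | x ∈ f i n ∧ ball x (1 / ((m : ℝ) + 1)) ⊆ i.1 ∧ ∀ j, r j i → x ∉ j.1}
  have hD : ∀ n m, PPorous P (⋃ i, D n m i) := by
    intro n m x hx
    obtain ⟨i, hi⟩ := mem_iUnion.1 hx
    rw [hP.2.1]
    refine ⟨1 / ((m : ℝ) + 1), by positivity, ?_⟩
    refine hP.1 x _ (f i n) ?_ (hf i n x hi.1)
    rintro y ⟨hy, hyb⟩
    obtain ⟨j, hj⟩ := mem_iUnion.1 hy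
    have hyD : ∀ k, y ∈ f k n → y ∈ k.1 := fun k hk => by
      have : y ∈ k.1 ∩ A := by rw [hfA]; exact mem_iUnion.2 ⟨n, hk⟩
      exact this.1
    have hxD : ∀ k, x ∈ f k n → x ∈ k.1 := fun k hk => by
      have : x ∈ k.1 ∩ A := by rw [hfA]; exact mem_iUnion.2 ⟨n, hk⟩
      exact this.1
    rcases trichotomous_of r i j with h | h | h
    · exact absurd (hi.2.1 hyb) (hj.2.2 i h)
    · subst h; exact hj.1
    · exact absurd (hj.2.1 (mem_ball_comm.1 hyb)) (hi.2.2 j h)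
  refine sigmaPPorous_mono hP ?_
    (sigmaPPorous_iUnion fun n => sigmaPPorous_iUnion fun m => sigmaPPorous_of_pPorous (hD n m))
  rintro x ⟨hxA, hxk⟩
  have : ∃ i : I, x ∈ i.1 := by
    by_contra hcon
    apply hxk
    refine ⟨hxA, ?_⟩
    rintro ⟨U, hU, hxU⟩
    exact hcon ⟨⟨U, hU⟩, hxU⟩
  have wf : WellFounded r := IsWellFounded.wf
  let i := wf.min {i : I | x ∈ i.1} this
  have hxi : x ∈ i.1 := wf.min_mem {i : I | x ∈ i.1} this
  have hmin : ∀ j, r j i → x ∉ j.1 := fun j hj hx =>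
    wf.not_lt_min {i : I | x ∈ i.1} hx hj
  have hx2 : x ∈ i.1 ∩ A := ⟨hxi, hxA⟩
  rw [hfA] at hx2
  obtain ⟨n, hn⟩ := mem_iUnion.1 hx2
  obtain ⟨ε, hε, hb⟩ := Metric.isOpen_iff.1 i.2.1 x hxi
  obtain ⟨m, hm⟩ := exists_nat_one_div_lt hε
  exact mem_iUnion.2 ⟨n, mem_iUnion.2 ⟨m, mem_iUnion.2
    ⟨i, hn, (ball_subset_ball hm.le).trans hb, hmin⟩⟩⟩

/-- nowhere σ-porous -/
def NowhereSP {X : Type*} [MetricSpace X] (P : X → Set X → Prop) (A : Set X) : Prop :=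
  ∀ U, IsOpen U → SigmaPPorous P (U ∩ A) → U ∩ A = ∅

theorem nowhereSP_kerP {X : Type*} [MetricSpace X] {P : X → Set X → Prop}
    (hP : IsPorosityLike X P) (A : Set X) : NowhereSP P (kerP P A) := by
  intro U hU h
  have h2 : SigmaPPorous P (U ∩ A) := by
    refine sigmaPPorous_mono hP ?_ (sigmaPPorous_union h (sigmaPPorous_diff_kerP hP A))
    rintro x ⟨hx, hxA⟩
    by_cases hk : x ∈ kerP P A
    · exact Or.inl ⟨hx, hk⟩
    · exact Or.inr ⟨hxA, hk⟩
  ext x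
  simp only [mem_inter_iff, mem_empty_iff_false, iff_false, not_and]
  exact fun hx hk => hk.2 ⟨U, ⟨hU, h2⟩, hx⟩

theorem kerP_closed {X : Type*} [MetricSpace X] (P : X → Set X → Prop) (A : Set X) :
    ∃ C, IsClosed C ∧ kerP P A = A ∩ C :=
  ⟨_, (isOpen_sUnion fun _ hU => hU.1).isClosed_compl, diff_eq _ _⟩

theorem mem_suslinOp {X : Type*} {A : List ℕ → Set X} {x : X} :
    x ∈ SuslinOp A ↔ ∃ ν : ℕ → ℕ, ∀ n, x ∈ A (seg ν n) := by
  simp [SuslinOp]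

theorem seg_succ (ν : ℕ → ℕ) (n : ℕ) : seg ν (n + 1) = seg ν n ++ [ν n] := by
  simp [seg, List.range_succ]

theorem seg_succ' (ν : ℕ → ℕ) (n : ℕ) : seg ν (n + 1) = ν 0 :: seg (fun i => ν (i + 1)) n := by
  simp [seg, List.range_succ_eq_map, Function.comp_def]

theorem seg_map (f : ℕ → ℕ) (ν : ℕ → ℕ) (n : ℕ) : (seg ν n).map f = seg (fun i => f (ν i)) n := by
  simp [seg, Function.comp_def]

def ufst (n : ℕ) : ℕ := n.unpair.1

def usnd (n : ℕ) : ℕ := n.unpair.2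

theorem suslinOp_inter {X : Type*} (A C : List ℕ → Set X) (K : Set X) :
    SuslinOp (fun u => A (u.map ufst) ∩ C (u.map usnd) ∩ K)
      = SuslinOp A ∩ SuslinOp C ∩ K := by
  ext x
  simp only [mem_inter_iff, mem_suslinOp, seg_map]
  constructor
  · rintro ⟨ν, h⟩
    exact ⟨⟨⟨_, fun n => (h n).1.1⟩, ⟨_, fun n => (h n).1.2⟩⟩, (h 0).2⟩
  · rintro ⟨⟨⟨ν, h⟩, ⟨μ, h'⟩⟩, hK⟩
    refine ⟨fun i => Nat.pair (ν i) (μ i), fun n => ⟨⟨?_, ?_⟩, hK⟩⟩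
    · simpa [ufst] using h n
    · simpa [usnd] using h' n

/-- good schemes -/
def GoodScheme {X : Type*} [MetricSpace X] (P : X → Set X → Prop) (A : List ℕ → Set X) : Prop :=
  (∀ s, IsClosed (A s)) ∧ (SuslinOp A).Nonempty ∧ NowhereSP P (SuslinOp A)

theorem good_step {X : Type*} [MetricSpace X] {P : X → Set X → Prop}
    (hP : IsPorosityLike X P) (hNP : ∀ A : Set X, IsSuslin A → IsSuslin (NP P A))
    (A : List ℕ → Set X) (hA : GoodScheme P A) :
    ∃ (ch : ℕ → List ℕ → Set X) (κ : ℕ → ℕ), (∀ j, GoodScheme P (ch j)) ∧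
      (∀ j u, ch j u ⊆ A (κ j :: u.map ufst)) ∧
      (∀ j, SuslinOp (ch j) ⊆ NP P (SuslinOp A)) ∧
      SuslinOp A ⊆ closure (⋃ j, SuslinOp (ch j)) := by
  classical
  obtain ⟨hcl, hne, hnow⟩ := hA
  obtain ⟨C, hC, hCN⟩ := hNP (SuslinOp A) ⟨A, hcl, rfl⟩
  let Nk : ℕ → Set X := fun k => SuslinOp (fun u => A (k :: u)) ∩ SuslinOp C
  choose Cl hCl hker using fun k => kerP_closed P (Nk k)
  let ch : ℕ → List ℕ → Set X := fun k u => A (k :: u.map ufst) ∩ C (u.map usnd) ∩ Cl k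
  have hch : ∀ k, SuslinOp (ch k) = kerP P (Nk k) := by
    intro k
    rw [hker]
    exact suslinOp_inter (fun u => A (k :: u)) C (Cl k)
  have hdense : SuslinOp A ⊆ closure (⋃ k, kerP P (Nk k)) := by
    have h1 : SigmaPPorous P ((closure (⋃ k, kerP P (Nk k)))ᶜ ∩ SuslinOp A) := by
      have hp : PPorous P (SuslinOp A \ NP P (SuslinOp A)) := by
        rintro x ⟨hx, hx'⟩
        refine hP.1 x _ _ diff_subset ?_
        by_contra hc
        exact hx' ⟨hx, hc⟩
      refine sigmaPPorous_mono hP ?_ (sigmaPPorous_union (sigmaPPorous_of_pPorous hp)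
        (sigmaPPorous_iUnion fun k => sigmaPPorous_diff_kerP hP (Nk k)))
      rintro x ⟨hx, hxA⟩
      by_cases hN : x ∈ NP P (SuslinOp A)
      · right
        obtain ⟨ν, hν⟩ := mem_suslinOp.1 hxA
        refine mem_iUnion.2 ⟨ν 0, ⟨mem_suslinOp.2 ⟨fun i => ν (i + 1), fun n => ?_⟩, ?_⟩, ?_⟩
        · have := hν (n + 1)
          rwa [seg_succ'] at this
        · rw [hCN]; exact hN
        · exact fun hk => hx (subset_closure (mem_iUnion.2 ⟨_, hk⟩))
      · exact Or.inl ⟨hxA, hN⟩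
    have h2 := hnow _ isClosed_closure.isOpen_compl h1
    intro x hx
    by_contra hc
    have : x ∈ (∅ : Set X) := by rw [← h2]; exact ⟨hc, hx⟩
    exact this
  have hex : ∃ k, (kerP P (Nk k)).Nonempty := by
    obtain ⟨x, hx⟩ := hne
    have := closure_nonempty_iff.1 ⟨x, hdense hx⟩
    exact nonempty_iUnion.1 this
  obtain ⟨k0, hk0⟩ := hex
  let κ : ℕ → ℕ := fun j => if (kerP P (Nk j)).Nonempty then j else k0
  have hκ : ∀ j, (kerP P (Nk (κ j))).Nonempty := by
    intro j
    by_cases h : (kerP P (Nk j)).Nonempty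
    · simp only [κ, if_pos h]; exact h
    · simp only [κ, if_neg h]; exact hk0
  refine ⟨fun j => ch (κ j), κ, fun j => ⟨fun s => ?_, ?_, ?_⟩, fun j u x hx => hx.1.1,
    fun j => ?_, ?_⟩
  · exact ((hcl _).inter (hC _)).inter (hCl _)
  · rw [hch]; exact hκ j
  · rw [hch]; exact nowhereSP_kerP hP _
  · rw [hch, ← hCN]
    exact fun x hx => hx.1.2
  · refine hdense.trans (closure_mono ?_)
    intro x hx
    obtain ⟨k, hk⟩ := mem_iUnion.1 hx
    refine mem_iUnion.2 ⟨k, ?_⟩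
    have : κ k = k := if_pos ⟨x, hk⟩
    rw [hch, this]
    exact hk

theorem exists_foran_scheme_of_non_sigma_porous
    {X : Type*} [MetricSpace X] [CompleteSpace X]
    (P : X → Set X → Prop) (hP : IsPorosityLike X P)
    (B : Set (Set X)) (hB : TopologicalSpace.IsTopologicalBasis B)
    (hNP : ∀ A : Set X, IsSuslin A → IsSuslin (NP P A))
    (S : Set X) (hS : IsSuslin S) (hnp : ¬ SigmaPPorous P S) :
    ∃ F : List ℕ → Set X, IsForanScheme B P F ∧ ∀ t, F t ⊆ S := by
  classical
  obtain ⟨A, hA, hAS⟩ := hS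
  obtain ⟨K, hK, hker⟩ := kerP_closed P S
  have hA0 : SuslinOp (fun u => A (u.map ufst) ∩ A (u.map usnd) ∩ K) = kerP P S := by
    rw [suslinOp_inter, hker, hAS, inter_self]
  let St := {A : List ℕ → Set X // GoodScheme P A}
  let T0 : St := ⟨fun u => A (u.map ufst) ∩ A (u.map usnd) ∩ K,
    fun s => ((hA _).inter (hA _)).inter hK, by
      rw [hA0]
      by_contra hc
      apply hnp
      have := sigmaPPorous_diff_kerP hP S
      rwa [not_nonempty_iff_eq_empty.1 hc, diff_empty] at this, by
      rw [hA0]; exact nowhereSP_kerP hP S⟩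
  choose ch κ hgood hsub hN hdense using fun T : St => good_step hP hNP T.1 T.2
  let step : St → ℕ → St := fun T j => ⟨ch T j, hgood T j⟩
  let T : List ℕ → St := fun t => t.foldl step T0
  have hT : ∀ t j, T (t ++ [j]) = step (T t) j := fun t j => by simp [T, List.foldl_append]
  let F : List ℕ → Set X := fun t => SuslinOp (T t).1
  have hFN : ∀ t j, F (t ++ [j]) ⊆ NP P (F t) := fun t j => by
    simp only [F, hT]; exact hN (T t) j
  have hFsub : ∀ t j, F (t ++ [j]) ⊆ F t := fun t j x hx => (hFN t j hx).1
  have hFS : ∀ t, F t ⊆ S := by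
    intro t
    induction t using List.reverseRecOn with
    | nil =>
      have : F [] = kerP P S := hA0
      rw [this]; exact diff_subset
    | append_singleton t j ih => exact (hFsub t j).trans ih
  refine ⟨F, ⟨fun t => (T t).2.2.1, fun t => ⟨iUnion_subset (hFsub t), ?_⟩,
    fun t k x hx => (hFN t k hx).2, ?_⟩, hFS⟩
  · have := hdense (T t)
    simp only [F, hT]; exact this
  intro ν G _ hdiam hcl hne
  choose y hy using hne
  have hanti : Antitone G := antitone_nat_of_succ_le fun n => subset_closure.trans (hcl n)
  have hcau : CauchySeq y := by
    rw [EMetric.cauchySeq_iff]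
    intro ε hε
    obtain ⟨N, hN⟩ := (hdiam.eventually (gt_mem_nhds hε)).exists
    refine ⟨N, fun m hm n hn => lt_of_le_of_lt ?_ hN⟩
    exact EMetric.edist_le_diam_of_mem (hanti hm (hy m).2) (hanti hn (hy n).2)
  obtain ⟨x, hx⟩ := cauchySeq_tendsto_of_complete hcau
  have hFanti : Antitone (fun n => F (seg ν n)) := antitone_nat_of_succ_le fun n => by
    rw [seg_succ]; exact hFsub _ _
  have hxG : ∀ n, x ∈ G n := fun n => hcl n <|
    mem_closure_of_tendsto hx (eventually_atTop.2 ⟨n + 1, fun m hm => hanti hm (hy m).2⟩)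
  have hxF : ∀ n, x ∈ closure (F (seg ν n)) := fun n =>
    mem_closure_of_tendsto hx (eventually_atTop.2 ⟨n, fun m hm => hFanti hm (hy m).1⟩)
  refine ⟨x, mem_iInter.2 fun m => ⟨?_, hxG m⟩⟩
  let k : ℕ → ℕ := fun n => κ (T (seg ν n)) (ν n)
  have hone : ∀ n u, (T (seg ν (n + 1))).1 u ⊆ (T (seg ν n)).1 (k n :: u.map ufst) := by
    intro n u
    rw [seg_succ, hT]
    exact hsub _ _ _
  let μ : ℕ → ℕ := fun i => ufst^[i] (k (m + i))
  have hmany : ∀ l u, (T (seg ν (m + l))).1 u ⊆ (T (seg ν m)).1 (seg μ l ++ u.map ufst^[l]) := by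
    intro l
    induction l with
    | zero => intro u; simp [seg]
    | succ l ih =>
      intro u
      refine (hone (m + l) u).trans ((ih _).trans ?_)
      rw [seg_succ]
      simp [μ, Function.iterate_succ]
  refine mem_suslinOp.2 ⟨μ, fun l => ?_⟩
  refine closure_minimal ?_ ((T (seg ν m)).2.1 _) (hxF (m + l))
  intro z hz
  obtain ⟨ρ, hρ⟩ := mem_suslinOp.1 hz
  have := hmany l [] (by simpa [seg] using hρ 0)
  simpa using this
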